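/- Let A be a weighted pushdown system. There exists n_A ∈ ℕ such that if there exists a valid path π from a configuration c₁ to a configuration c_r with c₁ a local minima of π and w(π) ≥ n_A, then at least one of the following holds: (1) A has a good cycle reachable from c₁; (2) for every n' ∈ ℕ there exists a valid path π' from c₁ to c_r such that c₁ is a local minima of π' and w(π') > n'. -/

import Mathlib

open scoped BigOperators

namespace PDS

/-- Stack commands over a stack alphabet `Γ`. -/
inductive Com (Γ : Type) where
  | skip : Com Γ
  | pop : Com Γ
  | push (z : Γ) : Com Γ
  deriving DecidableEq

/-- Action of a stack command on a stack string (top of stack at the head). -/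
def Com.apply {Γ : Type} : Com Γ → List Γ → List Γ
  | .skip, α => α
  | .pop, α => α.tail
  | .push z, α => z :: α

/-- A transition (edge) of a pushdown system. -/
structure Edge (Q Γ : Type) where
  q1 : Q
  top : Γ
  q2 : Q
  com : Com Γ
  deriving DecidableEq

/-- A weighted pushdown system. -/
structure WPS (Q Γ : Type) where
  q0 : Q
  bot : Γ
  E : Set (Edge Q Γ)
  w : Edge Q Γ → ℤ
  no_push_bot : ∀ e ∈ E, e.com ≠ Com.push bot
  no_pop_bot : ∀ e ∈ E, e.top = bot → e.com ≠ Com.pop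

variable {Q Γ : Type}

/-- A configuration: stack string (top at head) together with a state. -/
abbrev Config (Q Γ : Type) := List Γ × Q

/-- A genuine configuration has a nonempty stack string. -/
def IsConfig (c : Config Q Γ) : Prop := c.1 ≠ []

/-- The initial configuration `(⊥, q₀)`. -/
def WPS.start (A : WPS Q Γ) : Config Q Γ := ([A.bot], A.q0)

/-- The configuration obtained by taking the edge `e` from `c`. -/
def next (c : Config Q Γ) (e : Edge Q Γ) : Config Q Γ := (e.com.apply c.1, e.q2)

/-- The edge `e` is enabled at configuration `c`. -/
def WPS.Enabled (A : WPS Q Γ) (c : Config Q Γ) (e : Edge Q Γ) : Prop :=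
  e ∈ A.E ∧ c.2 = e.q1 ∧ c.1.head? = some e.top

/-- Validity of a finite path, given by a start configuration and a list of edges. -/
def WPS.Valid (A : WPS Q Γ) : Config Q Γ → List (Edge Q Γ) → Prop
  | _, [] => True
  | c, e :: es => A.Enabled c e ∧ A.Valid (next c e) es

/-- Last configuration of the finite path `(c, es)`. -/
def endc (c : Config Q Γ) (es : List (Edge Q Γ)) : Config Q Γ := es.foldl next c

/-- The list of configurations along the finite path `(c, es)`. -/
def trace (c : Config Q Γ) (es : List (Edge Q Γ)) : List (Config Q Γ) :=
  List.scanl next c es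

/-- Total weight of a finite path. -/
def WPS.wt (A : WPS Q Γ) (es : List (Edge Q Γ)) : ℤ := (es.map A.w).sum

/-- Stack height of a configuration. -/
def height (c : Config Q Γ) : ℕ := c.1.length

/-- Stack height of a finite path: maximal stack height along it. -/
def SH (c : Config Q Γ) (es : List (Edge Q Γ)) : ℕ :=
  ((trace c es).map height).foldr max 0

/-- Additional stack height of a finite path. -/
def ASH (c : Config Q Γ) (es : List (Edge Q Γ)) : ℕ :=
  SH c es - max (height c) (height (endc c es))

/-- The first configuration of the path is a local minima: its stack string is a
prefix (here: suffix of the list, since the top is at the head) of all stack strings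
along the path. -/
def FirstMin (c : Config Q Γ) (es : List (Edge Q Γ)) : Prop :=
  ∀ c' ∈ trace c es, c.1 <:+ c'.1

/-- The edge sequence obtained from `u ++ p₁ ++ v ++ p₂ ++ x` by repeating `p₁` and
`p₂` each `j` times in place. -/
def pumped (u p₁ v p₂ x : List (Edge Q Γ)) (j : ℕ) : List (Edge Q Γ) :=
  u ++ (List.replicate j p₁).flatten ++ v ++ (List.replicate j p₂).flatten ++ x

/-- `(p₁, p₂)` is a pumpable pair of paths for the path `(c, es)`. -/
def WPS.PumpablePair (A : WPS Q Γ) (c : Config Q Γ) (es p₁ p₂ : List (Edge Q Γ)) : Prop :=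
  p₁ ≠ [] ∧ p₂ ≠ [] ∧
    ∃ u v x, es = u ++ p₁ ++ v ++ p₂ ++ x ∧
      ∀ j : ℕ, A.Valid c (pumped u p₁ v p₂ x j)

/-- The path `(c, es)` has a pumpable pair of paths. -/
def WPS.HasPumpablePair (A : WPS Q Γ) (c : Config Q Γ) (es : List (Edge Q Γ)) : Prop :=
  ∃ p₁ p₂, A.PumpablePair c es p₁ p₂

/-- `(c, es)` is a good cycle. -/
def WPS.GoodCycle (A : WPS Q Γ) (c : Config Q Γ) (es : List (Edge Q Γ)) : Prop :=
  A.Valid c es ∧ 0 < A.wt es ∧ FirstMin c es ∧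
    (endc c es).2 = c.2 ∧ (endc c es).1.head? = c.1.head?

/-- `A` has a good cycle reachable from the configuration `c`. -/
def WPS.ReachableGoodCycleFrom (A : WPS Q Γ) (c : Config Q Γ) : Prop :=
  ∃ es₀ es, A.Valid c es₀ ∧ A.GoodCycle (endc c es₀) es

/-- `A` has a good cycle (at some configuration). -/
def WPS.HasGoodCycle (A : WPS Q Γ) : Prop :=
  ∃ c es, IsConfig c ∧ A.GoodCycle c es

/-- The finite path `(c, es)` contains a good cycle. -/
def ContainsGoodCycle (A : WPS Q Γ) (c : Config Q Γ) (es : List (Edge Q Γ)) : Prop :=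
  ∃ es₁ es₂, es = es₁ ++ es₂ ∧ A.GoodCycle (endc c es₁) es₂

/-- Configurations along an infinite path given by an infinite edge sequence. -/
def confs (c : Config Q Γ) (f : ℕ → Edge Q Γ) : ℕ → Config Q Γ
  | 0 => c
  | n + 1 => next (confs c f n) (f n)

/-- Validity of the infinite path `(c, f)`. -/
def WPS.ValidInf (A : WPS Q Γ) (c : Config Q Γ) (f : ℕ → Edge Q Γ) : Prop :=
  ∀ n, A.Enabled (confs c f n) (f n)

/-- Average weight of the prefix of length `n+1` of an infinite path. -/
noncomputable def avgPref (A : WPS Q Γ) (f : ℕ → Edge Q Γ) (n : ℕ) : ℝ :=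
  (∑ i ∈ Finset.range (n + 1), (A.w (f i) : ℝ)) / (n + 1)

/-- Limit-sup of the averages along an infinite path. -/
noncomputable def LimSupAvg (A : WPS Q Γ) (f : ℕ → Edge Q Γ) : ℝ :=
  Filter.limsup (avgPref A f) Filter.atTop

/-- Limit-inf of the averages along an infinite path. -/
noncomputable def LimInfAvg (A : WPS Q Γ) (f : ℕ → Edge Q Γ) : ℝ :=
  Filter.liminf (avgPref A f) Filter.atTop

/-- An infinite edge sequence is ultimately periodic. -/
def UltPeriodic (f : ℕ → Edge Q Γ) : Prop :=
  ∃ N p : ℕ, 0 < p ∧ ∀ n, N ≤ n → f (n + p) = f n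

/-- The infinite path `(c, f)` is stack bounded. -/
def StackBounded (c : Config Q Γ) (f : ℕ → Edge Q Γ) : Prop :=
  ∃ n : ℕ, ∀ k, height (confs c f k) ≤ n

/-- Non-decreasing path: a valid path whose first configuration is a local minima. -/
def WPS.NonDec (A : WPS Q Γ) (c : Config Q Γ) (es : List (Edge Q Γ)) : Prop :=
  A.Valid c es ∧ FirstMin c es

/-- Summary function, valued in `EReal`: `⊥` means there is no non-decreasing path
from `(⊥γ,q₁)` to `(⊥γ,q₂)`, `⊤` means `ω` (weights unbounded from above), and
otherwise the value is the maximal weight of such a path. -/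
noncomputable def WPS.summary (A : WPS Q Γ) (q₁ : Q) (γ : Γ) (q₂ : Q) : EReal :=
  sSup { x : EReal | ∃ es, A.NonDec ([γ, A.bot], q₁) es ∧
    endc ([γ, A.bot], q₁) es = ([γ, A.bot], q₂) ∧ x = ((A.wt es : ℝ) : EReal) }

/-- Stack height bounded summary function: as `summary` but only over non-decreasing
paths of additional stack height at most `d`. -/
noncomputable def WPS.summaryBdd (A : WPS Q Γ) (d : ℕ) (q₁ : Q) (γ : Γ) (q₂ : Q) : EReal :=
  sSup { x : EReal | ∃ es, A.NonDec ([γ, A.bot], q₁) es ∧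
    endc ([γ, A.bot], q₁) es = ([γ, A.bot], q₂) ∧ ASH ([γ, A.bot], q₁) es ≤ d ∧
    x = ((A.wt es : ℝ) : EReal) }

/-- Edges of the summary graph `Gr(A)` together with their weights in `EReal`
(`⊤` plays the role of `ω`): skip edges weighted by the summary function and push
edges weighted by the corresponding transition weight. -/
def WPS.GrEdge (A : WPS Q Γ) (v₁ v₂ : Q × Γ) (x : EReal) : Prop :=
  (v₁.2 = v₂.2 ∧ A.summary v₁.1 v₁.2 v₂.1 ≠ ⊥ ∧ x = A.summary v₁.1 v₁.2 v₂.1) ∨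
  (∃ e ∈ A.E, e.q1 = v₁.1 ∧ e.top = v₁.2 ∧ e.q2 = v₂.1 ∧ e.com = Com.push v₂.2 ∧
    x = ((A.w e : ℝ) : EReal))

/-- The summary graph `Gr(A)` has a positive simple cycle: a simple cycle containing
an `ω`-edge or whose total weight is positive. -/
def WPS.PosSimpleCycle (A : WPS Q Γ) : Prop :=
  ∃ (k : ℕ) (v : Fin (k + 1) → Q × Γ) (x : Fin (k + 1) → EReal),
    Function.Injective v ∧ (∀ i, A.GrEdge (v i) (v (i + 1)) (x i)) ∧
    ((∃ i, x i = ⊤) ∨ (0 : EReal) < ∑ i, x i)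

/-- Weight of a finite path under the shifted weight function `w + r`. -/
def WPS.wtQ (A : WPS Q Γ) (r : ℚ) (es : List (Edge Q Γ)) : ℚ :=
  (es.map (fun e => (A.w e : ℚ) + r)).sum

/-- The shifted system `A^r` (weight function `w + r`) has a good cycle. -/
def WPS.GoodCycleShift (A : WPS Q Γ) (r : ℚ) : Prop :=
  ∃ c es, IsConfig c ∧ A.Valid c es ∧ 0 < A.wtQ r es ∧ FirstMin c es ∧
    (endc c es).2 = c.2 ∧ (endc c es).1.head? = c.1.head?

end PDS

namespace PDS

variable {Q Γ : Type}

theorem endc_append (c : Config Q Γ) (a b : List (Edge Q Γ)) :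
    endc c (a ++ b) = endc (endc c a) b := List.foldl_append

theorem WPS.valid_append (A : WPS Q Γ) (c : Config Q Γ) (a b : List (Edge Q Γ)) :
    A.Valid c (a ++ b) ↔ A.Valid c a ∧ A.Valid (endc c a) b := by
  induction a generalizing c with
  | nil => simp [WPS.Valid, endc]
  | cons e a ih => simp [WPS.Valid, ih, endc, and_assoc]

theorem WPS.wt_append (A : WPS Q Γ) (a b : List (Edge Q Γ)) :
    A.wt (a ++ b) = A.wt a + A.wt b := by
  simp [WPS.wt]

/-- Every stack string along the path `(c, es)` extends `α`. -/
def Above (α : List Γ) (c : Config Q Γ) (es : List (Edge Q Γ)) : Prop :=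
  ∀ c' ∈ trace c es, α <:+ c'.1

theorem above_nil {α : List Γ} {c : Config Q Γ} : Above α c [] ↔ α <:+ c.1 := by
  simp [Above, trace]

theorem above_cons {α : List Γ} {c : Config Q Γ} {e : Edge Q Γ} {es : List (Edge Q Γ)} :
    Above α c (e :: es) ↔ α <:+ c.1 ∧ Above α (next c e) es := by
  simp [Above, trace]

theorem Above.head {α : List Γ} {c : Config Q Γ} {es : List (Edge Q Γ)} (h : Above α c es) :
    α <:+ c.1 := by
  cases es with
  | nil => exact above_nil.1 h
  | cons e es => exact (above_cons.1 h).1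

theorem above_append {α : List Γ} {c : Config Q Γ} {a b : List (Edge Q Γ)} :
    Above α c (a ++ b) ↔ Above α c a ∧ Above α (endc c a) b := by
  induction a generalizing c with
  | nil =>
    simp only [List.nil_append, above_nil, endc, List.foldl_nil]
    exact ⟨fun h => ⟨h.head, h⟩, And.right⟩
  | cons e a ih =>
    simp only [List.cons_append, above_cons, ih, endc, List.foldl_cons, and_assoc]

theorem Above.trans {α β : List Γ} {c : Config Q Γ} {es : List (Edge Q Γ)} (h : Above β c es)
    (hα : α <:+ β) : Above α c es :=
  fun c' hc' => hα.trans (h c' hc')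

/-- A path that never drops below `γ :: α` can be replayed on top of any `γ :: α'`. -/
theorem WPS.Valid.replay {A : WPS Q Γ} {γ : Γ} {α : List Γ} (α' : List Γ)
    {es : List (Edge Q Γ)} {δ : List Γ} {q : Q} (hv : A.Valid (δ ++ γ :: α, q) es)
    (ha : Above (γ :: α) (δ ++ γ :: α, q) es) :
    A.Valid (δ ++ γ :: α', q) es ∧ Above (γ :: α') (δ ++ γ :: α', q) es ∧
      ∃ δ' q', endc (δ ++ γ :: α, q) es = (δ' ++ γ :: α, q') ∧
        endc (δ ++ γ :: α', q) es = (δ' ++ γ :: α', q') := by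
  induction es generalizing δ q with
  | nil => exact ⟨trivial, above_nil.2 (List.suffix_append _ _), δ, q, rfl, rfl⟩
  | cons e es ih =>
    obtain ⟨⟨hE, hq, ht⟩, hv⟩ := hv
    have ha := (above_cons.1 ha).2
    obtain ⟨δ₁, h₁, h₂⟩ : ∃ δ₁, next (δ ++ γ :: α, q) e = (δ₁ ++ γ :: α, e.q2) ∧
        next (δ ++ γ :: α', q) e = (δ₁ ++ γ :: α', e.q2) := by
      cases hc : e.com with
      | skip => exact ⟨δ, by simp [next, hc, Com.apply], by simp [next, hc, Com.apply]⟩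
      | push z => exact ⟨z :: δ, by simp [next, hc, Com.apply], by simp [next, hc, Com.apply]⟩
      | pop =>
        cases δ with
        | nil =>
          have := ha.head.length_le
          simp [next, hc, Com.apply] at this
        | cons d δ => exact ⟨δ, by simp [next, hc, Com.apply], by simp [next, hc, Com.apply]⟩
    rw [h₁] at hv ha
    obtain ⟨hv', ha', δ', q', he, he'⟩ := ih hv ha
    refine ⟨⟨⟨hE, hq, ?_⟩, h₂ ▸ hv'⟩,
      above_cons.2 ⟨List.suffix_append _ _, h₂ ▸ ha'⟩, δ', q', ?_, ?_⟩
    · cases δ <;> simpa using ht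
    · simpa [endc, h₁] using he
    · simpa [endc, h₂] using he'

/-- A path on top of `z :: α` that stays above `α` without ever returning to `α` stays above
`z :: α`. -/
theorem Above.cons_of_ne {z : Γ} {α : List Γ} {es : List (Edge Q Γ)} {c : Config Q Γ}
    (hc : z :: α <:+ c.1) (ha : Above α c es)
    (hne : ∀ x y, es = x ++ y → (endc c x).1 ≠ α) : Above (z :: α) c es := by
  induction es generalizing c with
  | nil => exact above_nil.2 hc
  | cons e es ih =>
    refine above_cons.2 ⟨hc, ih ?_ (above_cons.1 ha).2 fun x y h => ?_⟩
    · have h₁ : (next c e).1 ≠ α := hne [e] es rfl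
      obtain ⟨δ, hδ⟩ := hc
      cases hcom : e.com with
      | skip => exact ⟨δ, by simp [next, hcom, Com.apply, hδ]⟩
      | push y => exact ⟨y :: δ, by simp [next, hcom, Com.apply, hδ]⟩
      | pop =>
        cases δ with
        | nil => simp [next, hcom, Com.apply, ← hδ] at h₁
        | cons d δ => exact ⟨δ, by simp [next, hcom, Com.apply, ← hδ]⟩
    · exact hne (e :: x) y (by simp [h])

/-- A property of splittings of a list that holds for the trivial splitting has a last
splitting where it holds. -/
theorem exists_last_split {τ : Type*} (l : List τ) (P : List τ → List τ → Prop) (h : P [] l) :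
    ∃ a b, l = a ++ b ∧ P a b ∧ ∀ x y, b = x ++ y → P (a ++ x) y → x = [] := by
  induction l generalizing P with
  | nil => exact ⟨[], [], rfl, h, fun x y hxy _ => (List.append_eq_nil_iff.1 hxy.symm).1⟩
  | cons e t ih =>
    by_cases hex : ∃ x y, t = x ++ y ∧ P (e :: x) y
    · obtain ⟨x₀, y₀, rfl, hP⟩ := hex
      obtain ⟨a, b, hab, hPab, hlast⟩ :=
        ih (fun a b => ∃ x y, a ++ b = x ++ y ∧ a <+: x ∧ P (e :: x) y)
          ⟨x₀, y₀, rfl, List.nil_prefix, hP⟩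
      obtain ⟨x, y, hxy, ⟨d, rfl⟩, hPxy⟩ := hPab
      have hb : b = d ++ y := by simpa using hxy
      obtain rfl := hlast d y hb ⟨a ++ d, y, rfl, List.prefix_rfl, hPxy⟩
      refine ⟨e :: a, b, by simp [hab], by simpa [hb] using hPxy, fun u v huv hu => ?_⟩
      exact hlast u v huv ⟨a ++ u, v, rfl, List.prefix_rfl, hu⟩
    · push Not at hex
      refine ⟨[], e :: t, rfl, h, fun x y hxy hP => ?_⟩
      cases x with
      | nil => rfl
      | cons f x =>
        simp only [List.cons_append, List.cons.injEq] at hxy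
        obtain ⟨rfl, rfl⟩ := hxy
        exact absurd hP (hex x y rfl)

theorem WPS.ReachableGoodCycleFrom.of_endc {A : WPS Q Γ} {c : Config Q Γ}
    {a : List (Edge Q Γ)} (hv : A.Valid c a) (h : A.ReachableGoodCycleFrom (endc c a)) :
    A.ReachableGoodCycleFrom c := by
  obtain ⟨es₀, es, h₀, hg⟩ := h
  exact ⟨a ++ es₀, es, (A.valid_append c a es₀).2 ⟨hv, h₀⟩, by rwa [endc_append]⟩

/-- Every subpath of `(c, es)` that starts at a local minima and ends with the same stack string
has weight at most `B`. -/
def WPS.LevelBounded (A : WPS Q Γ) (B : ℤ) (c : Config Q Γ) (es : List (Edge Q Γ)) : Prop :=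
  ∀ a b d, es = a ++ b ++ d → FirstMin (endc c a) b →
    (endc c (a ++ b)).1 = (endc c a).1 → A.wt b ≤ B

theorem WPS.LevelBounded.suffix {A : WPS Q Γ} {B : ℤ} {c : Config Q Γ} {a b : List (Edge Q Γ)}
    (h : A.LevelBounded B c (a ++ b)) : A.LevelBounded B (endc c a) b := by
  intro x y z hb hm he
  refine h (a ++ x) y z (by simp [hb]) (by rwa [endc_append]) ?_
  rwa [List.append_assoc, endc_append, endc_append c]

/-- Without reachable good cycles, the weight of a path whose local minima take their state and
top symbol in `S` is at most linear in the size of `S`. -/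
theorem WPS.wt_le_of_levelBounded [DecidableEq Q] [DecidableEq Γ] {A : WPS Q Γ} {B W : ℤ}
    (hB : 0 ≤ B) (hW : 0 ≤ W) (hw : ∀ e, A.w e ≤ W) {n : ℕ} {S : Finset (Q × Γ)}
    (hS : S.card ≤ n) {c : Config Q Γ} {es : List (Edge Q Γ)} (hv : A.Valid c es)
    (hm : FirstMin c es) (hg : ¬ A.ReachableGoodCycleFrom c)
    (hmem : ∀ a b, es = a ++ b → FirstMin (endc c a) b →
      ∃ p ∈ S, (endc c a).2 = p.1 ∧ (endc c a).1.head? = some p.2)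
    (hl : A.LevelBounded B c es) : A.wt es ≤ (B + W) * n := by
  induction n generalizing S c es with
  | zero =>
    obtain ⟨p, hp, -⟩ := hmem [] es rfl hm
    simp_all
  | succ n ih =>
    obtain ⟨p, hp, hp₁, hp₂⟩ := hmem [] es rfl hm
    simp only [endc, List.foldl_nil] at hp₁ hp₂
    obtain ⟨a, b, rfl, ⟨hab, ha₁, ha₂⟩, hlast⟩ := exists_last_split es
      (fun a b => FirstMin (endc c a) b ∧ (endc c a).2 = p.1 ∧ (endc c a).1.head? = some p.2)
      ⟨hm, hp₁, hp₂⟩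
    obtain ⟨hva, hvb⟩ := (A.valid_append c a b).1 hv
    have hwa : A.wt a ≤ 0 := by
      by_contra! hpos
      exact hg ⟨[], a, trivial, hva, hpos, (above_append.1 hm).1, ha₁.trans hp₁.symm,
        ha₂.trans hp₂.symm⟩
    obtain ⟨b₁, b₂, rfl, hb₁, hlast'⟩ := exists_last_split b
      (fun x _ => (endc (endc c a) x).1 = (endc c a).1) rfl
    have hab' := above_append.1 hab
    have hwb₁ : A.wt b₁ ≤ B :=
      hl a b₁ b₂ (by simp) hab'.1 (by rw [endc_append, hb₁])
    obtain ⟨-, hvb₂⟩ := (A.valid_append _ b₁ b₂).1 hvb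
    have hn : 0 ≤ (B + W) * n := by positivity
    cases b₂ with
    | nil =>
      simp only [A.wt_append, show A.wt [] = 0 from rfl]
      push_cast
      linarith
    | cons e r =>
      set c' := endc (endc c a) b₁ with hc'
      have hnext : endc c (a ++ b₁ ++ [e]) = next c' e := by
        rw [endc_append, endc_append]; rfl
      have har := (above_cons.1 hab'.2).2
      obtain ⟨z, hz⟩ : ∃ z, (next c' e).1 = z :: (endc c a).1 := by
        cases hcom : e.com with
        | push z => exact ⟨z, by simp [next, hcom, Com.apply, hb₁]⟩
        | skip =>
          have := hlast' [e] r rfl (by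
            rw [endc_append]; change (next c' e).1 = _; simp [next, hcom, Com.apply, hb₁])
          simp at this
        | pop =>
          have h := har.head.length_le
          have : (endc c a).1 ≠ [] := by
            intro h; simp [h] at ha₂
          have := List.length_pos_iff.2 this
          simp [next, hcom, Com.apply, hb₁] at h
          omega
      have hmr : FirstMin (next c' e) r := by
        change Above _ _ _
        rw [hz]
        refine Above.cons_of_ne (by rw [hz]) har fun x y hxy hx => ?_
        have := hlast' (e :: x) y (by simp [hxy]) (by rw [endc_append]; exact hx)
        simp at this
      have hvr : A.Valid c (a ++ b₁ ++ [e]) := by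
        have : A.Valid c ((a ++ b₁ ++ [e]) ++ r) := by simpa using hv
        exact ((A.valid_append _ _ _).1 this).1
      have hr : A.wt r ≤ (B + W) * n := by
        refine ih (S := S.erase p) (by rw [Finset.card_erase_of_mem hp]; omega)
          hvb₂.2 hmr (fun h => hg (.of_endc hvr (hnext ▸ h))) (fun x y hxy hxm => ?_) ?_
        · rw [← hnext, ← endc_append] at hxm ⊢
          obtain ⟨p', hp', h₁, h₂⟩ := hmem (a ++ b₁ ++ [e] ++ x) y (by simp [hxy]) hxm
          refine ⟨p', Finset.mem_erase.2 ⟨?_, hp'⟩, h₁, h₂⟩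
          rintro rfl
          have := hlast (b₁ ++ e :: x) y (by simp [hxy])
            (by simpa using And.intro hxm (And.intro h₁ h₂))
          simp at this
        · rw [← hnext]
          exact WPS.LevelBounded.suffix (by simpa using hl)
      have hwe := hw e
      have hcons : A.wt (e :: r) = A.w e + A.wt r := by simp [WPS.wt]
      rw [A.wt_append, A.wt_append, hcons]
      push_cast
      linarith

instance [Finite Γ] : Finite (Com Γ) :=
  Finite.of_injective (β := Option (Option Γ))
    (fun | .skip => none | .pop => some none | .push z => some (some z))
    (by rintro (_ | _ | _) (_ | _ | _) h <;> simp_all)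

instance [Finite Q] [Finite Γ] : Finite (Edge Q Γ) :=
  Finite.of_injective (fun e : Edge Q Γ => (e.q1, e.top, e.q2, e.com))
    (by rintro ⟨⟩ ⟨⟩ h; simp_all)

/-- `x` is the weight of a non-decreasing path from `([γ], q)` to `([γ], q')`. -/
def WPS.LevelWeight (A : WPS Q Γ) (t : Q × Γ × Q) (x : ℤ) : Prop :=
  ∃ es, A.NonDec ([t.2.1], t.1) es ∧ endc ([t.2.1], t.1) es = ([t.2.1], t.2.2) ∧ A.wt es = x

/-- A bound on all level weights that do not belong to an unbounded set of level weights. -/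
theorem WPS.exists_levelWeight_bound [Finite Q] [Finite Γ] (A : WPS Q Γ) :
    ∃ B : ℤ, 0 ≤ B ∧ ∀ t x, A.LevelWeight t x → B < x → ∀ n, ∃ y, A.LevelWeight t y ∧ n < y := by
  have key : ∀ t, ∃ B : ℤ, ∀ x, A.LevelWeight t x → B < x →
      ∀ n, ∃ y, A.LevelWeight t y ∧ n < y := by
    intro t
    by_cases h : ∃ n, ∀ y, A.LevelWeight t y → y ≤ n
    · obtain ⟨n, hn⟩ := h
      exact ⟨n, fun x hx hlt => absurd (hn x hx) (not_le.2 hlt)⟩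
    · push Not at h
      exact ⟨0, fun _ _ _ => h⟩
  choose f hf using key
  obtain ⟨M, hM⟩ := (Set.finite_range f).bddAbove
  refine ⟨max 0 M, le_max_left _ _, fun t x hx hlt => hf t x hx ?_⟩
  exact lt_of_le_of_lt ((hM ⟨t, rfl⟩).trans (le_max_right _ _)) hlt

end PDS

open PDS in
/-- there is a bound `n_A` such that any valid path from `c₁` (a local
minima) to `c_r` of weight at least `n_A` implies either a reachable good cycle from
`c₁`, or paths from `c₁` to `c_r` (with `c₁` a local minima) of arbitrarily large
weight. -/
theorem big_weight_implies_omega_or_good_cycle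
    {Q Γ : Type} [Fintype Q] [Fintype Γ] (A : WPS Q Γ) :
    ∃ N : ℕ, ∀ (c₁ : Config Q Γ) (es : List (Edge Q Γ)),
      IsConfig c₁ → A.Valid c₁ es → FirstMin c₁ es → (N : ℤ) ≤ A.wt es →
      (A.ReachableGoodCycleFrom c₁ ∨
        ∀ n' : ℕ, ∃ es', A.Valid c₁ es' ∧ endc c₁ es' = endc c₁ es ∧
          FirstMin c₁ es' ∧ (n' : ℤ) < A.wt es') := by
  classical
  obtain ⟨B, hB, hBt⟩ := A.exists_levelWeight_bound
  obtain ⟨W, hW⟩ := (Set.finite_range A.w).bddAbove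
  refine ⟨((B + max 0 W) * (Finset.univ : Finset (Q × Γ)).card + 1).toNat,
    fun c₁ es hc hv hm hN => or_iff_not_imp_left.2 fun hg => ?_⟩
  by_cases hl : A.LevelBounded B c₁ es
  · have hle := WPS.wt_le_of_levelBounded (S := Finset.univ) hB (le_max_left 0 W)
      (fun e => (hW ⟨e, rfl⟩).trans (le_max_right _ _)) le_rfl hv hm hg (fun a b hab _ => ?_) hl
    · omega
    · have hne : (endc c₁ a).1 ≠ [] := by
        intro h
        have := (above_append.1 (hab ▸ hm : Above c₁.1 c₁ (a ++ b))).2.head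
        rw [h, List.suffix_nil] at this
        exact hc this
      obtain ⟨γ, α, h⟩ := List.exists_cons_of_ne_nil hne
      exact ⟨((endc c₁ a).2, γ), Finset.mem_univ _, rfl, by simp [h]⟩
  · simp only [WPS.LevelBounded, not_forall, not_le] at hl
    obtain ⟨a, b, d, rfl, hmb, hst, hlt⟩ := hl
    intro n'
    obtain ⟨hvab, hvd⟩ := (A.valid_append _ _ _).1 hv
    obtain ⟨hva, hvb⟩ := (A.valid_append _ _ _).1 hvab
    obtain ⟨hmab, hmd⟩ := above_append.1 (hm : Above c₁.1 c₁ (a ++ b ++ d))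
    obtain ⟨hma, hmb'⟩ := above_append.1 hmab
    have hsuf := hmb'.head
    rw [endc_append] at hst
    have hne : (endc c₁ a).1 ≠ [] := by
      intro h
      rw [h, List.suffix_nil] at hsuf
      exact hc hsuf
    obtain ⟨γ, α, h⟩ := List.exists_cons_of_ne_nil hne
    obtain ⟨q, hq⟩ : ∃ q, endc c₁ a = (γ :: α, q) := ⟨(endc c₁ a).2, by rw [← h]⟩
    rw [hq] at hvb hmb hst hsuf
    obtain ⟨hv₁, hm₁, δ, q', he, he₁⟩ := WPS.Valid.replay (δ := []) [] hvb hmb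
    simp only [List.nil_append] at hv₁ hm₁ he he₁
    have hδ : δ = [] := by simpa [he] using hst
    subst hδ
    obtain ⟨_, ⟨es', ⟨hv', hm'⟩, he', rfl⟩, hlt'⟩ :=
      hBt (q, γ, q') _ ⟨b, ⟨hv₁, hm₁⟩, he₁, rfl⟩ hlt (n' - A.wt a - A.wt d)
    obtain ⟨hv₂, hm₂, δ, q'', h₁, h₂⟩ := WPS.Valid.replay (δ := []) α hv' hm'
    simp only [List.nil_append] at hv₂ hm₂ h₁ h₂
    have hend : endc c₁ (a ++ es') = endc c₁ (a ++ b) := by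
      rw [endc_append, endc_append, hq, he, h₂]
      have h₃ := h₁.symm.trans he'
      simp only [Prod.mk.injEq, List.append_eq_singleton_iff] at h₃
      simp_all
    refine ⟨a ++ es' ++ d, ?_, ?_, ?_, ?_⟩
    · rw [A.valid_append, A.valid_append, hend, hq]
      exact ⟨⟨hva, hv₂⟩, hvd⟩
    · rw [endc_append, hend, ← endc_append]
    · refine above_append.2 ⟨above_append.2 ⟨hma, ?_⟩, hend ▸ hmd⟩
      rw [hq]
      exact hm₂.trans hsuf
    · rw [A.wt_append, A.wt_append]
      linarith
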